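/- arXiv:1501.04861 — 2 statements merged into one kernel-verified Lean document; each statement's English description precedes it below -/
import Mathlib

section
/- There exists a constant C > 0 such that for all integers n ≥ 1, |(1/(2n)) · (4^{−n} · binom(2n, n))² − 1/(2π (n − 3/8)(n + 5/8))| ≤ C/n⁴. (Note that 1/(2π (n − 3/8)(n + 5/8)) = ∫_{n−3/8}^{n+5/8} dt/(2π t²).) -/
open Real

/-- The squared return probability `(4^{-n} binom(2n,n))²` of simple random walk on `ℤ²`. -/
noncomputable def returnProb (n : ℕ) : ℝ := ((Nat.centralBinom n : ℝ) / 4 ^ n) ^ 2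

lemma returnProb_pos (n : ℕ) : 0 < returnProb n := by
  have : (0 : ℝ) < Nat.centralBinom n := by exact_mod_cast Nat.centralBinom_pos n
  unfold returnProb
  positivity

lemma returnProb_succ (n : ℕ) :
    returnProb (n + 1) = returnProb n * ((2 * n + 1) / (2 * n + 2)) ^ 2 := by
  have h : ((n : ℝ) + 1) * Nat.centralBinom (n + 1) = 2 * (2 * n + 1) * Nat.centralBinom n := by
    exact_mod_cast Nat.succ_mul_centralBinom_succ n
  have h' : (Nat.centralBinom (n + 1) : ℝ) = 2 * (2 * n + 1) * Nat.centralBinom n / (n + 1) := by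
    rw [eq_div_iff (by positivity), ← h, mul_comm]
  unfold returnProb
  rw [h', pow_succ (4 : ℝ), ← mul_pow]
  congr 1
  rw [show (2 : ℝ) * n + 2 = 2 * (n + 1) by ring]
  field_simp
  ring

lemma returnProb_mul_wallis (n : ℕ) : returnProb n * (2 * n + 1) * Wallis.W n = 1 := by
  induction n with
  | zero => simp [returnProb, Wallis.W]
  | succ k ih =>
    rw [Wallis.W_succ, returnProb_succ]
    push_cast
    calc _ = returnProb k * (2 * k + 1) * Wallis.W k := by
          field_simp
          ring
      _ = 1 := ih

lemma tendsto_returnProb_mul :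
    Filter.Tendsto (fun n : ℕ => returnProb n * (2 * n + 1)) Filter.atTop (nhds (2 / π)) := by
  have h := Wallis.tendsto_W_nhds_pi_div_two.inv₀ (by positivity)
  rw [inv_div] at h
  refine h.congr fun n => ?_
  exact (eq_inv_of_mul_eq_one_left (returnProb_mul_wallis n)).symm

/-- If `g n = n + O(1)`, then `returnProb n * g n` tends to `1 / π`. -/
lemma tendsto_returnProb_mul_of_bounded {g : ℕ → ℝ} (hg : ∀ n, |g n - n| ≤ 1) :
    Filter.Tendsto (fun n => returnProb n * g n) Filter.atTop (nhds (1 / π)) := by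
  have hr : Filter.Tendsto (fun n : ℕ => g n / (2 * n + 1)) Filter.atTop (nhds (1 / 2)) := by
    rw [tendsto_iff_dist_tendsto_zero]
    have hz := (tendsto_one_div_add_atTop_nhds_zero_nat (𝕜 := ℝ)).const_mul 2
    rw [mul_zero] at hz
    refine squeeze_zero (fun _ => dist_nonneg) (fun n => ?_) hz
    have h := abs_le.1 (hg n)
    have hn : (0 : ℝ) ≤ n := n.cast_nonneg
    rw [Real.dist_eq, abs_le, mul_one_div, ← neg_div, div_sub_div _ _ (by positivity) (by norm_num),
      div_le_div_iff₀ (by positivity) (by positivity),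
      div_le_div_iff₀ (by positivity) (by positivity)]
    constructor <;> nlinarith
  have h := tendsto_returnProb_mul.mul hr
  rw [show 2 / π * (1 / 2) = 1 / π by ring] at h
  refine h.congr fun n => ?_
  field_simp

lemma returnProb_mul_le (n : ℕ) : returnProb n * (n + 1 / 4) ≤ 1 / π := by
  have hm : Monotone fun n : ℕ => returnProb n * ((n : ℝ) + 1 / 4) := by
    refine monotone_nat_of_le_succ fun n => ?_
    rw [returnProb_succ, mul_assoc]
    refine mul_le_mul_of_nonneg_left ?_ (returnProb_pos n).le
    push_cast
    rw [div_pow, div_mul_eq_mul_div, le_div_iff₀ (by positivity)]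
    nlinarith
  refine hm.ge_of_tendsto (tendsto_returnProb_mul_of_bounded fun n => ?_) n
  rw [add_sub_cancel_left]
  norm_num

lemma le_returnProb_mul {n : ℕ} (hn : 1 ≤ n) :
    1 / π ≤ returnProb n * (n + 1 / 4 + 1 / (16 * n)) := by
  have hm : Antitone fun k : ℕ =>
      returnProb (k + 1) * (((k + 1 : ℕ) : ℝ) + 1 / 4 + 1 / (16 * (k + 1 : ℕ))) := by
    refine antitone_nat_of_succ_le fun k => ?_
    rw [returnProb_succ (k + 1), mul_assoc]
    refine mul_le_mul_of_nonneg_left ?_ (returnProb_pos _).le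
    push_cast
    have hk : (0 : ℝ) ≤ k := k.cast_nonneg
    rw [← sub_nonneg]
    have : ((k : ℝ) + 1 + 1 / 4 + 1 / (16 * (k + 1))) -
        ((2 * (k + 1) + 1) / (2 * (k + 1) + 2)) ^ 2 *
          (k + 1 + 1 + 1 / 4 + 1 / (16 * (k + 1 + 1))) =
        (4 * (k + 1) ^ 2 + 7 * (k + 1) + 4) / (64 * (k + 1) * (k + 2) ^ 3) := by
      rw [show (2 * ((k : ℝ) + 1) + 2) = 2 * (k + 2) by ring,
        show (k : ℝ) + 1 + 1 = k + 2 by ring]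
      field_simp
      ring
    rw [this]
    positivity
  have ht := (tendsto_returnProb_mul_of_bounded
    (g := fun n : ℕ => (n : ℝ) + 1 / 4 + 1 / (16 * n)) fun n => by
      have h : (1 : ℝ) / (16 * n) ≤ 1 / 16 := by
        rcases n.eq_zero_or_pos with rfl | hn
        · norm_num
        · have : (1 : ℝ) ≤ n := by exact_mod_cast hn
          exact one_div_le_one_div_of_le (by norm_num) (by linarith)
      have h0 : (0 : ℝ) ≤ 1 / (16 * n) := by positivity
      rw [abs_le]
      constructor <;> linarith).comp (Filter.tendsto_add_atTop_nat 1)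
  obtain ⟨k, rfl⟩ := Nat.exists_eq_add_of_le' hn
  exact hm.le_of_tendsto ht k

/-- There is a constant `C > 0` such that for all `n ≥ 1`,
`|(1/(2n)) (4^{-n} binom(2n,n))² − 1/(2π(n − 3/8)(n + 5/8))| ≤ C/n⁴`. -/
theorem rooted_loop_measure_brownian_comparison :
    ∃ C : ℝ, 0 < C ∧ ∀ n : ℕ, 1 ≤ n →
      |(1 / (2 * (n : ℝ))) * ((4 : ℝ) ^ (-(n : ℤ)) * (Nat.choose (2 * n) n : ℝ)) ^ 2 -
        1 / (2 * π * ((n : ℝ) - 3 / 8) * ((n : ℝ) + 5 / 8))| ≤ C / (n : ℝ) ^ 4 := by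
  refine ⟨1, one_pos, fun n hn => ?_⟩
  have hP : ((4 : ℝ) ^ (-(n : ℤ)) * (Nat.choose (2 * n) n : ℝ)) ^ 2 = returnProb n := by
    rw [returnProb, Nat.centralBinom, zpow_neg, zpow_natCast, inv_mul_eq_div]
  rw [hP]
  have hu := returnProb_mul_le n
  have hl := le_returnProb_mul hn
  have hx : (1 : ℝ) ≤ n := by exact_mod_cast hn
  generalize returnProb n = p at hu hl
  generalize (n : ℝ) = x at hu hl hx
  set A := x ^ 2 + x / 4 - 15 / 64 with hA
  have hxA : x ^ 2 ≤ A := by linarith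
  have hA0 : 0 < A := by nlinarith
  have hπ := pi_pos
  have hq : 1 / (2 * π * (x - 3 / 8) * (x + 5 / 8)) = 1 / (2 * π) * (1 / A) := by
    rw [show 2 * π * (x - 3 / 8) * (x + 5 / 8) = 2 * π * A by rw [hA]; ring, one_div_mul_one_div]
  have hup : 1 / (2 * x) * p ≤ 1 / (2 * π) * (1 / (A + 15 / 64)) := by
    have h : p ≤ 1 / π / (x + 1 / 4) := (le_div_iff₀ (by positivity)).2 hu
    calc 1 / (2 * x) * p ≤ 1 / (2 * x) * (1 / π / (x + 1 / 4)) := by gcongr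
      _ = _ := by
        rw [show A + 15 / 64 = x * (x + 1 / 4) by rw [hA]; ring]
        field_simp
  have hlow : 1 / (2 * π) * (1 / (A + 19 / 64)) ≤ 1 / (2 * x) * p := by
    have h : 1 / π / (x + 1 / 4 + 1 / (16 * x)) ≤ p := (div_le_iff₀ (by positivity)).2 hl
    calc _ = 1 / (2 * x) * (1 / π / (x + 1 / 4 + 1 / (16 * x))) := by
          rw [show A + 19 / 64 = x * (x + 1 / 4 + 1 / (16 * x)) by rw [hA]; field_simp; ring]
          field_simp
      _ ≤ _ := by gcongr
  have hdiff : 1 / A - 1 / (A + 19 / 64) ≤ 1 / x ^ 4 := by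
    rw [div_sub_div _ _ hA0.ne' (by positivity), div_le_div_iff₀ (by positivity) (by positivity)]
    have : x ^ 4 ≤ A * A := by nlinarith [sq_nonneg x]
    nlinarith
  have hc : 1 / (2 * π) ≤ 1 := by
    rw [div_le_one (by positivity)]
    linarith [pi_gt_three]
  have hx4 : 0 < 1 / x ^ 4 := by positivity
  have hgap : 1 / (2 * π) * (1 / A) - 1 / (2 * π) * (1 / (A + 19 / 64)) ≤ 1 / x ^ 4 := by
    rw [← mul_sub]
    calc _ ≤ 1 / (2 * π) * (1 / x ^ 4) := by gcongr
      _ ≤ 1 * (1 / x ^ 4) := by gcongr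
      _ = _ := one_mul _
  have hle : 1 / (2 * π) * (1 / (A + 15 / 64)) ≤ 1 / (2 * π) * (1 / A) := by
    gcongr
    linarith
  rw [hq, abs_le]
  constructor <;> linarith
end

section
/- There is a function c₃ of (K, G, c₁) ∈ [0,∞)³ with the following property. Let N ≥ 2 and M ≥ 1 be integers and set t̃ := M/(2N²); assume t̃ ≥ N^{−1/6}. Let t > 0 satisfy |t − t̃| ≤ (5/8) N^{−2}. Let g : ℂ → [0, ∞) be Lipschitz with Lipschitz constant K and bounded above by G. Let γ : [0, t] → ℂ be continuous and let γ̃ : [0, t̃] → ℂ be Lipschitz with constant 2N, and assume sup_{0 ≤ s ≤ 1} |γ(s t) − γ̃(s t̃)| ≤ c₁ (log N)/N. Then |∫₀ᵗ g(γ(s)) ds − (1/(2N²)) ∑_{k=0}^{M−1} g(γ̃(k/(2N²)))| ≤ c₃(K, G, c₁) · t · (log N)/N. -/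
open Real

/-- A Riemann-sum error bound: if `f` stays within `ε` of `v k` on the `k`-th of `M` equal pieces
of `[0, t]`, then its integral is within `t * ε` of the corresponding Riemann sum. -/
theorem abs_integral_sub_equipartition_sum_le {f : ℝ → ℝ} {t ε : ℝ} {M : ℕ} (hM : 0 < M)
    (ht : 0 < t) (hf : ContinuousOn f (Set.Icc 0 t)) (v : ℕ → ℝ)
    (h : ∀ k < M, ∀ s ∈ Set.Icc ((k : ℝ) * (t / M)) (((k + 1 : ℕ) : ℝ) * (t / M)),
      |f s - v k| ≤ ε) :
    |(∫ s in (0 : ℝ)..t, f s) - (t / M) * ∑ k ∈ Finset.range M, v k| ≤ t * ε := by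
  have hMr : (0 : ℝ) < M := by exact_mod_cast hM
  have hd : 0 < t / M := div_pos ht hMr
  have hle (k : ℕ) : (k : ℝ) * (t / M) ≤ ((k + 1 : ℕ) : ℝ) * (t / M) := by
    push_cast; nlinarith
  have hlen (k : ℕ) : ((k + 1 : ℕ) : ℝ) * (t / M) - (k : ℝ) * (t / M) = t / M := by
    push_cast; ring
  have hint : ∀ k < M, IntervalIntegrable f MeasureTheory.volume
      ((k : ℝ) * (t / M)) (((k + 1 : ℕ) : ℝ) * (t / M)) := by
    intro k hk
    apply ContinuousOn.intervalIntegrable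
    rw [Set.uIcc_of_le (hle k)]
    refine hf.mono (Set.Icc_subset_Icc (by positivity) ?_)
    have hk' : ((k + 1 : ℕ) : ℝ) ≤ M := by exact_mod_cast hk
    calc ((k + 1 : ℕ) : ℝ) * (t / M) ≤ M * (t / M) := by gcongr
      _ = t := by field_simp
  have hsum := intervalIntegral.sum_integral_adjacent_intervals
    (a := fun k : ℕ => (k : ℝ) * (t / M)) hint
  have hend : (M : ℝ) * (t / M) = t := by field_simp
  simp only [Nat.cast_zero, zero_mul, hend] at hsum
  rw [← hsum, Finset.mul_sum, ← Finset.sum_sub_distrib]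
  calc _ ≤ ∑ k ∈ Finset.range M, |(∫ s in (k : ℝ) * (t / M)..((k + 1 : ℕ) : ℝ) * (t / M), f s)
          - t / M * v k| := Finset.abs_sum_le_sum_abs _ _
    _ ≤ ∑ k ∈ Finset.range M, ε * (t / M) := by
      refine Finset.sum_le_sum fun k hk => ?_
      have hk := Finset.mem_range.1 hk
      have hconst : t / M * v k
          = ∫ _ in (k : ℝ) * (t / M)..((k + 1 : ℕ) : ℝ) * (t / M), v k := by
        rw [intervalIntegral.integral_const, hlen, smul_eq_mul]
      rw [hconst, ← intervalIntegral.integral_sub (hint k hk) intervalIntegrable_const]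
      have hb := intervalIntegral.norm_integral_le_of_norm_le_const (C := ε)
        (f := fun s => f s - v k) (a := (k : ℝ) * (t / M)) (b := ((k + 1 : ℕ) : ℝ) * (t / M))
        (fun s hs => by
          rw [Set.uIoc_of_le (hle k)] at hs
          exact h k hk s (Set.Ioc_subset_Icc_self hs))
      rwa [hlen, abs_of_pos hd] at hb
    _ = t * ε := by
      rw [Finset.sum_const, Finset.card_range, nsmul_eq_mul]; field_simp

/-- Deterministic Riemann-sum approximation estimate comparing the killing weight
`∫₀ᵗ g(γ(s)) ds` of a (Brownian) loop `γ` of duration `t` with the killing weight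
`(1/(2N²)) ∑_{k<M} g(γ'(k/(2N²)))` of a coupled rescaled random walk loop `γ'` with `M` steps
and duration `t̃ = M/(2N²) ≥ N^{−1/6}`, when `|t − t̃| ≤ (5/8)N^{−2}`, `g` is nonnegative,
`K`-Lipschitz and bounded by `G`, `γ'` is `2N`-Lipschitz on `[0, t̃]`, and the two loops
satisfy `sup_{0≤s≤1} |γ(st) − γ'(st̃)| ≤ c₁ (log N)/N`: the difference is at most
`c₃(K,G,c₁) · t · (log N)/N`. -/
theorem loop_killing_weight_comparison :
    ∃ c₃ : ℝ → ℝ → ℝ → ℝ, ∀ K G c₁ : ℝ, 0 ≤ K → 0 ≤ G → 0 ≤ c₁ →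
      ∀ N M : ℕ, 2 ≤ N → 1 ≤ M →
      (N : ℝ) ^ (-(1 / 6 : ℝ)) ≤ (M : ℝ) / (2 * (N : ℝ) ^ 2) →
      ∀ t : ℝ, 0 < t → |t - (M : ℝ) / (2 * (N : ℝ) ^ 2)| ≤ (5 / 8) / (N : ℝ) ^ 2 →
      ∀ g : ℂ → ℝ, (∀ x, 0 ≤ g x) → (∀ x y, |g x - g y| ≤ K * dist x y) →
        (∀ x, g x ≤ G) →
      ∀ γ : ℝ → ℂ, ContinuousOn γ (Set.Icc 0 t) →
      ∀ γ' : ℝ → ℂ,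
        (∀ s₁ ∈ Set.Icc (0 : ℝ) ((M : ℝ) / (2 * (N : ℝ) ^ 2)),
         ∀ s₂ ∈ Set.Icc (0 : ℝ) ((M : ℝ) / (2 * (N : ℝ) ^ 2)),
            dist (γ' s₁) (γ' s₂) ≤ 2 * (N : ℝ) * |s₁ - s₂|) →
        (∀ s ∈ Set.Icc (0 : ℝ) 1,
            dist (γ (s * t)) (γ' (s * ((M : ℝ) / (2 * (N : ℝ) ^ 2)))) ≤
              c₁ * Real.log N / N) →
        |(∫ s in (0 : ℝ)..t, g (γ s)) -
            (1 / (2 * (N : ℝ) ^ 2)) * ∑ k ∈ Finset.range M, g (γ' ((k : ℝ) / (2 * (N : ℝ) ^ 2)))|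
          ≤ c₃ K G c₁ * t * Real.log N / N := by
  refine ⟨fun K G c₁ => K * (c₁ + 2) + 2 * G, ?_⟩
  intro K G c₁ hK hG _ N M hN hM hT t ht htT g hg0 hgK hgG γ hγ γ' hγ' hclose
  have hN2 : (2 : ℝ) ≤ N := by exact_mod_cast hN
  have hNpos : (0 : ℝ) < N := by linarith
  have hMr : (0 : ℝ) < M := by exact_mod_cast hM
  have hlog : 1 / 2 ≤ Real.log N := by
    have h1 := Real.log_two_gt_d9
    have h2 := Real.log_le_log (by norm_num) hN2
    linarith
  have hTN : 1 / (N : ℝ) ≤ (M : ℝ) / (2 * (N : ℝ) ^ 2) := by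
    refine le_trans ?_ hT
    rw [one_div, ← Real.rpow_neg_one]
    exact Real.rpow_le_rpow_of_exponent_le (by linarith) (by norm_num)
  have htN : 11 / 16 ≤ t * N := by
    have h1 := (abs_le.1 htT).1
    have h2 : 1 / (N : ℝ) - (5 / 8) / (N : ℝ) ^ 2 ≤ t := by linarith
    have h3 : (1 / (N : ℝ) - (5 / 8) / (N : ℝ) ^ 2) * N = 1 - (5 / 8) / N := by field_simp
    have h4 : (5 / 8) / (N : ℝ) ≤ 5 / 16 := by
      rw [div_le_iff₀ hNpos]; linarith
    nlinarith
  have hgcont : Continuous g :=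
    (LipschitzWith.of_dist_le_mul (K := K.toNNReal) fun x y => by
      rw [Real.dist_eq, Real.coe_toNNReal K hK]; exact hgK x y).continuous
  have hriem := abs_integral_sub_equipartition_sum_le (f := fun s => g (γ s))
    (ε := K * (c₁ * Real.log N / N + 1 / N)) hM ht (hgcont.comp_continuousOn hγ)
    (fun k => g (γ' ((k : ℝ) / (2 * (N : ℝ) ^ 2)))) (by
      intro k hk s hs
      have hk' : ((k : ℝ) + 1) ≤ M := by exact_mod_cast hk
      have hk0 : (0 : ℝ) ≤ k := k.cast_nonneg
      obtain ⟨hs1, hs2⟩ := hs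
      obtain ⟨u, rfl⟩ : ∃ u, s = u * t := ⟨s / t, by field_simp⟩
      have hu1 : (k : ℝ) ≤ u * M := by
        rw [← mul_div_assoc, div_le_iff₀ hMr] at hs1
        nlinarith
      have hu2 : u * M ≤ (k : ℝ) + 1 := by
        rw [← mul_div_assoc, le_div_iff₀ hMr] at hs2
        push_cast at hs2
        nlinarith
      have hu0 : 0 ≤ u := nonneg_of_mul_nonneg_left (hk0.trans hu1) hMr
      have hu1' : u ≤ 1 := by nlinarith
      have hd1 := hclose u ⟨hu0, hu1'⟩
      have hd2 := hγ' (u * ((M : ℝ) / (2 * (N : ℝ) ^ 2)))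
        ⟨by positivity, mul_le_of_le_one_left (by positivity) hu1'⟩
        ((k : ℝ) / (2 * (N : ℝ) ^ 2)) ⟨by positivity, by gcongr⟩
      have hd3 : 2 * (N : ℝ) * |u * ((M : ℝ) / (2 * (N : ℝ) ^ 2)) - (k : ℝ) / (2 * (N : ℝ) ^ 2)|
          ≤ 1 / N := by
        rw [← mul_div_assoc, ← sub_div, abs_of_nonneg (div_nonneg (by linarith) (by positivity))]
        calc 2 * (N : ℝ) * ((u * (M : ℝ) - k) / (2 * (N : ℝ) ^ 2) : ℝ)
            ≤ 2 * (N : ℝ) * (1 / (2 * (N : ℝ) ^ 2)) := by gcongr; linarith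
          _ = 1 / (N : ℝ) := by field_simp
      refine (hgK _ _).trans (mul_le_mul_of_nonneg_left ?_ hK)
      linarith [dist_triangle (γ (u * t)) (γ' (u * ((M : ℝ) / (2 * (N : ℝ) ^ 2))))
        (γ' ((k : ℝ) / (2 * (N : ℝ) ^ 2)))])
  set S := ∑ k ∈ Finset.range M, g (γ' ((k : ℝ) / (2 * (N : ℝ) ^ 2)))
  have hS0 : 0 ≤ S := Finset.sum_nonneg fun k _ => hg0 _
  have hSG : S ≤ M * G := by
    simpa using Finset.sum_le_card_nsmul (Finset.range M) _ G fun k _ => hgG _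
  have hmesh : |t / M * S - 1 / (2 * (N : ℝ) ^ 2) * S| ≤ (5 / 8) / (N : ℝ) ^ 2 * G := by
    have h1 : t / M * S - 1 / (2 * (N : ℝ) ^ 2) * S
        = (t - (M : ℝ) / (2 * (N : ℝ) ^ 2)) * (S / M) := by field_simp
    rw [h1, abs_mul, abs_of_nonneg (div_nonneg hS0 hMr.le)]
    have h2 : S / M ≤ G := by rw [div_le_iff₀ hMr]; linarith
    gcongr
  have hG2 : (5 / 8) / (N : ℝ) ^ 2 * G ≤ 2 * G * t * Real.log N / N := by
    have h1 : 5 / 8 ≤ 2 * (t * N) * Real.log N := by nlinarith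
    have h2 : 2 * G * t * Real.log N / N = (2 * (t * N) * Real.log N) / (N : ℝ) ^ 2 * G := by
      field_simp
    rw [h2]
    gcongr
  have hK2 : t * (K * (c₁ * Real.log N / N + 1 / N)) ≤ K * (c₁ + 2) * t * Real.log N / N := by
    have h1 : K * (c₁ + 2) * t * Real.log N / N
        = t * (K * (c₁ * Real.log N / N + 2 * Real.log N / N)) := by ring
    rw [h1]
    gcongr
    linarith
  calc _ ≤ _ := abs_sub_le _ (t / M * S) _
    _ ≤ K * (c₁ + 2) * t * Real.log N / N + 2 * G * t * Real.log N / N :=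
      add_le_add (hriem.trans hK2) (hmesh.trans hG2)
    _ = _ := by ring
end
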